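/- Let α be a circularly ordered type with orientation cocycle Or, and let v₀, v₁, v₂, v₃, v₄ ∈ α be pairwise distinct. Consider the chain A := Or(v₀,v₃,v₄)·(v₀,v₁,v₂) − Or(v₀,v₂,v₄)·(v₀,v₁,v₃) + Or(v₀,v₂,v₃)·(v₀,v₁,v₄) + Or(v₀,v₁,v₂)·(v₀,v₃,v₄) − Or(v₀,v₁,v₃)·(v₀,v₂,v₄) + Or(v₀,v₁,v₄)·(v₀,v₂,v₃) ∈ C₂(α). Then there exists a chain c ∈ C₂(α) such that A − c lies in the image of the boundary map ∂ : C₃(α) → C₂(α) and ‖c‖₁ ≤ 4. -/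

import Mathlib

noncomputable section

open Classical in
/-- The orientation cocycle of a circularly ordered type. -/
def orC {α : Type*} [CircularOrder α] (x y z : α) : ℝ :=
  if sbtw x y z then 1 else if sbtw x z y then -1 else 0


/-- `Chain X n` is the free `ℝ`-module on `(n+1)`-tuples of elements of `X`. -/
abbrev Chain (X : Type*) (n : ℕ) := (Fin (n + 1) → X) →₀ ℝ

/-- The ℓ¹-norm of a chain: the sum of the absolute values of its coefficients. -/
def l1 {X : Type*} {n : ℕ} (z : Chain X n) : ℝ := z.sum fun _ a => |a|

/-- The alternation operator on chains. -/
def alt {X : Type*} {n : ℕ} (z : Chain X n) : Chain X n :=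
  z.sum fun v a =>
    ((Nat.factorial (n + 1) : ℝ))⁻¹ •
      ∑ τ : Equiv.Perm (Fin (n + 1)),
        (((Equiv.Perm.sign τ : ℤ) : ℝ) * a) • Finsupp.single (v ∘ τ) 1

/-- The simplicial boundary map `C_{n+1}(X) → C_n(X)`, sending a tuple to the
alternating sum of its faces. -/
def bdry {X : Type*} {n : ℕ} (z : Chain X (n + 1)) : Chain X n :=
  z.sum fun v a =>
    ∑ i : Fin (n + 2), ((-1 : ℝ) ^ (i : ℕ) * a) • Finsupp.single (v ∘ i.succAbove) 1

theorem l1_add_le {X : Type*} {n : ℕ} (x y : Chain X n) : l1 (x + y) ≤ l1 x + l1 y := by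
  classical
  unfold l1
  rw [Finsupp.sum_of_support_subset (x + y) Finsupp.support_add _ (by simp),
    Finsupp.sum_of_support_subset x Finset.subset_union_left _ (by simp),
    Finsupp.sum_of_support_subset y Finset.subset_union_right _ (by simp),
    ← Finset.sum_add_distrib]
  exact Finset.sum_le_sum fun v _ => by simpa using abs_add_le (x v) (y v)

theorem l1_smul_single {X : Type*} {n : ℕ} (a : ℝ) (v : Fin (n + 1) → X) :
    l1 (a • Finsupp.single v 1 : Chain X n) = |a| := by
  simp [l1, Finsupp.sum_single_index]

theorem l1_four_smul_single_le {X : Type*} {n : ℕ} {a b c d : ℝ}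
    (ha : |a| ≤ 1) (hb : |b| ≤ 1) (hc : |c| ≤ 1) (hd : |d| ≤ 1) (p q r s : Fin (n + 1) → X) :
    l1 (a • Finsupp.single p 1 + b • Finsupp.single q 1 + c • Finsupp.single r 1
      + d • Finsupp.single s 1 : Chain X n) ≤ 4 := by
  refine (l1_add_le _ _).trans ?_
  have h₁ := l1_add_le (a • Finsupp.single p 1 + b • Finsupp.single q 1 : Chain X n)
    (c • Finsupp.single r 1)
  have h₂ := l1_add_le (a • Finsupp.single p 1 : Chain X n) (b • Finsupp.single q 1)
  simp only [l1_smul_single] at *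
  linarith

theorem bdry_single_tetrahedron {X : Type*} (p q r s : X) (a : ℝ) :
    bdry (Finsupp.single ![p, q, r, s] a : Chain X 3) =
      a • Finsupp.single ![q, r, s] 1 - a • Finsupp.single ![p, r, s] 1
        + a • Finsupp.single ![p, q, s] 1 - a • Finsupp.single ![p, q, r] 1 := by
  have h₀ : ![p, q, r, s] ∘ Fin.succAbove 0 = ![q, r, s] := by
    ext i; fin_cases i <;> rfl
  have h₁ : ![p, q, r, s] ∘ Fin.succAbove 1 = ![p, r, s] := by
    ext i; fin_cases i <;> rfl
  have h₂ : ![p, q, r, s] ∘ Fin.succAbove 2 = ![p, q, s] := by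
    ext i; fin_cases i <;> rfl
  have h₃ : ![p, q, r, s] ∘ Fin.succAbove 3 = ![p, q, r] := by
    ext i; fin_cases i <;> rfl
  unfold bdry
  rw [Finsupp.sum_single_index (by simp), Fin.sum_univ_four]
  simp only [Nat.reduceAdd, h₀, h₁, h₂, h₃]
  norm_num
  module

theorem abs_orC_le_one {α : Type*} [CircularOrder α] (x y z : α) : |orC x y z| ≤ 1 := by
  unfold orC
  split_ifs <;> simp

theorem orC_of_sbtw {α : Type*} [CircularOrder α] {x y z : α} (h : sbtw x y z) :
    orC x y z = 1 := if_pos h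

theorem orC_of_sbtw_swap {α : Type*} [CircularOrder α] {x y z : α} (h : sbtw x z y) :
    orC x y z = -1 :=
  (if_neg fun h' => sbtw_asymm h h'.cyclic_left).trans
    (if_pos h)

theorem sbtw_or_sbtw_swap {α : Type*} [CircularOrder α] {x y z : α} (hxy : x ≠ y) (hxz : x ≠ z)
    (hyz : y ≠ z) : sbtw x y z ∨ sbtw x z y := by
  by_contra! H
  have h₁ : btw z y x := btw_iff_not_sbtw.2 H.1
  have h₂ : btw y z x := btw_iff_not_sbtw.2 H.2
  rcases btw_antisymm h₁ h₂.cyclic_right with h | h | h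
  exacts [hyz h.symm, hxy h.symm, hxz h]

/-- Among four points distinct from each other and from a base point `o`, one comes first
when travelling around the circle from `o`. -/
theorem exists_first_of_four {α : Type*} [CircularOrder α] {o a b c d : α}
    (h : List.Pairwise (· ≠ ·) [o, a, b, c, d]) :
    (sbtw o a b ∧ sbtw o a c ∧ sbtw o a d) ∨ (sbtw o b a ∧ sbtw o b c ∧ sbtw o b d) ∨
      (sbtw o c a ∧ sbtw o c b ∧ sbtw o c d) ∨ (sbtw o d a ∧ sbtw o d b ∧ sbtw o d c) := by
  have htotal : ∀ {x y : α}, o ≠ x → o ≠ y → x ≠ y → sbtw o x y ∨ sbtw o y x :=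
    sbtw_or_sbtw_swap
  have htrans : ∀ {x y z : α}, sbtw o x y → sbtw o y z → sbtw o x z := sbtw_trans_right
  simp at h
  grind

theorem six_term_expression_reduces_to_four_terms {α : Type*} [CircularOrder α]
    (v₀ v₁ v₂ v₃ v₄ : α)
    (h : List.Pairwise (· ≠ ·) [v₀, v₁, v₂, v₃, v₄]) :
    ∃ c : Chain α 2,
      (∃ b : Chain α 3,
        bdry b =
          (orC v₀ v₃ v₄ • Finsupp.single ![v₀, v₁, v₂] 1
            - orC v₀ v₂ v₄ • Finsupp.single ![v₀, v₁, v₃] 1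
            + orC v₀ v₂ v₃ • Finsupp.single ![v₀, v₁, v₄] 1
            + orC v₀ v₁ v₂ • Finsupp.single ![v₀, v₃, v₄] 1
            - orC v₀ v₁ v₃ • Finsupp.single ![v₀, v₂, v₄] 1
            + orC v₀ v₁ v₄ • Finsupp.single ![v₀, v₂, v₃] 1) - c) ∧
      l1 c ≤ 4 := by
  have hor : ∀ x y, |orC v₀ x y| ≤ 1 := abs_orC_le_one v₀
  have hneg : ∀ x y, |-orC v₀ x y| ≤ 1 := fun x y => (abs_neg _).trans_le (hor x y)
  rcases exists_first_of_four h with ⟨h₂, h₃, h₄⟩ | ⟨h₁, h₃, h₄⟩ | ⟨h₁, h₂, h₄⟩ | ⟨h₁, h₂, h₃⟩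
  · refine ⟨_, ⟨Finsupp.single ![v₀, v₂, v₃, v₄] (-1), ?_⟩,
      l1_four_smul_single_le (a := 1) (by simp) (hor v₃ v₄) (hneg v₂ v₄) (hor v₂ v₃)
        ![v₂, v₃, v₄] ![v₀, v₁, v₂] ![v₀, v₁, v₃] ![v₀, v₁, v₄]⟩
    rw [bdry_single_tetrahedron, orC_of_sbtw h₂, orC_of_sbtw h₃, orC_of_sbtw h₄]
    module
  · refine ⟨_, ⟨Finsupp.single ![v₀, v₁, v₃, v₄] 1, ?_⟩,
      l1_four_smul_single_le (a := -1) (by simp) (hor v₃ v₄) (hneg v₁ v₃) (hor v₁ v₄)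
        ![v₁, v₃, v₄] ![v₀, v₁, v₂] ![v₀, v₂, v₄] ![v₀, v₂, v₃]⟩
    rw [bdry_single_tetrahedron, orC_of_sbtw_swap h₁, orC_of_sbtw h₃, orC_of_sbtw h₄]
    module
  · refine ⟨_, ⟨Finsupp.single ![v₀, v₁, v₂, v₄] (-1), ?_⟩,
      l1_four_smul_single_le (a := 1) (by simp) (hneg v₂ v₄) (hor v₁ v₂) (hor v₁ v₄)
        ![v₁, v₂, v₄] ![v₀, v₁, v₃] ![v₀, v₃, v₄] ![v₀, v₂, v₃]⟩
    rw [bdry_single_tetrahedron, orC_of_sbtw_swap h₁, orC_of_sbtw_swap h₂, orC_of_sbtw h₄]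
    module
  · refine ⟨_, ⟨Finsupp.single ![v₀, v₁, v₂, v₃] 1, ?_⟩,
      l1_four_smul_single_le (a := -1) (by simp) (hor v₂ v₃) (hor v₁ v₂) (hneg v₁ v₃)
        ![v₁, v₂, v₃] ![v₀, v₁, v₄] ![v₀, v₃, v₄] ![v₀, v₂, v₄]⟩
    rw [bdry_single_tetrahedron, orC_of_sbtw_swap h₁, orC_of_sbtw_swap h₂, orC_of_sbtw_swap h₃]
    module
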